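/- In the multi-server secure aggregation model with heterogeneous security constraints, if e* ≤ K−1 and either a* ≤ |𝒮̄|−1, or a* = |𝒮̄| and |𝒬| ≤ K−1, then the rate tuple (R_X, R_Y, R_{Z_Σ}) = (1, 1, e*) is achievable; that is, there exist a field size q, block length L, and random variables (Z_Σ, {Z_{u,v}}, {X_{u,v}}, {Y_u}) with L_X = L_Y = L and L_Σ = e*·L satisfying the structural, correctness and security constraints. -/

import Mathlib

open Finset

open scoped Classical

noncomputable section

/-- Probability that the random variable `X` takes the value `s`, under the weights `μ`. -/
def prb {Ω : Type} [Fintype Ω] (μ : Ω → ℝ) {α : Type} (X : Ω → α) (s : α) : ℝ :=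
  ∑ ω ∈ Finset.univ.filter fun ω => X ω = s, μ ω

/-- Shannon entropy of `X` in `q`-ary units. -/
def ent (q : ℕ) {Ω : Type} [Fintype Ω] (μ : Ω → ℝ) {α : Type} [Fintype α] (X : Ω → α) : ℝ :=
  -∑ s : α, prb μ X s * Real.logb q (prb μ X s)

/-- Conditional entropy `H(X | Y)` in `q`-ary units. -/
def condEnt (q : ℕ) {Ω : Type} [Fintype Ω] (μ : Ω → ℝ) {α β : Type} [Fintype α] [Fintype β]
    (X : Ω → α) (Y : Ω → β) : ℝ :=
  ent q μ (fun ω => (X ω, Y ω)) - ent q μ Y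

/-- Conditional mutual information `I(X ; Y ∣ Z)` in `q`-ary units. -/
def mutInfo (q : ℕ) {Ω : Type} [Fintype Ω] (μ : Ω → ℝ) {α β γ : Type}
    [Fintype α] [Fintype β] [Fintype γ] (X : Ω → α) (Y : Ω → β) (Z : Ω → γ) : ℝ :=
  condEnt q μ X Z - condEnt q μ X fun ω => (Y ω, Z ω)

/-- The joint random variable formed by the members of a family of random variables
indexed by a finset. -/
def restr {Ω ι α : Type} (Z : ι → Ω → α) (T : Finset ι) : Ω → { i // i ∈ T } → α :=
  fun ω i => Z i.1 ω

/-- The set of users `𝒦`: user `⟨u,v⟩` is the `v`-th user of server `u`. -/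
abbrev Usr (U : ℕ) (V : Fin U → ℕ) : Type := Σ u : Fin U, Fin (V u)

/-- Total number of users, `K = ∑ u, V u`. -/
def Ktot (U : ℕ) (V : Fin U → ℕ) : ℕ := ∑ u, V u

/-- The users connected to server `u`, `𝒦_{{u}}`. -/
def Ksrv (U : ℕ) (V : Fin U → ℕ) (u : Fin U) : Finset (Usr U V) :=
  Finset.univ.filter fun i => i.1 = u

/-- The users connected to a set of servers, `𝒦_𝒰`. -/
def KsrvSet (U : ℕ) (V : Fin U → ℕ) (A : Finset (Fin U)) : Finset (Usr U V) :=
  Finset.univ.filter fun i => i.1 ∈ A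

/-- The set of servers `𝒰^{(m,n)}` associated with a security input set `Sm` and a
colluding set `Tn`. -/
def UServers (U : ℕ) (V : Fin U → ℕ) (Sm Tn : Finset (Usr U V)) : Finset (Fin U) :=
  Finset.univ.filter fun u =>
    (Sm ∩ Ksrv U V u).Nonempty ∧ ((Sm ∪ Tn) ∩ Ksrv U V u).card = V u

/-- The set `(𝒮_m ∩ 𝒦_{{u}}) ∪ 𝒦_{𝒰^{(m,n)}} ∪ 𝒯_n`. -/
def BigB (U : ℕ) (V : Fin U → ℕ) (Sm Tn : Finset (Usr U V)) (u : Fin U) : Finset (Usr U V) :=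
  (Sm ∩ Ksrv U V u) ∪ KsrvSet U V (UServers U V Sm Tn) ∪ Tn

/-- The implicit security input set `𝒮_I`. -/
def SImp (U : ℕ) (V : Fin U → ℕ) {M N : ℕ} (S : Fin M → Finset (Usr U V))
    (T : Fin N → Finset (Usr U V)) : Finset (Usr U V) :=
  Finset.univ.filter fun i =>
    (∀ m, i ∉ S m) ∧
    ∃ u m n, (BigB U V (S m) (T n) u).card = Ktot U V - 1 ∧ i ∉ BigB U V (S m) (T n) u

/-- The total security input set `𝒮̄`. -/
def Sbar (U : ℕ) (V : Fin U → ℕ) {M N : ℕ} (S : Fin M → Finset (Usr U V))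
    (T : Fin N → Finset (Usr U V)) : Finset (Usr U V) :=
  (Finset.univ.biUnion fun m => S m) ∪ SImp U V S T

/-- The set `𝒜_{u,m,n}`. -/
def Aset (U : ℕ) (V : Fin U → ℕ) {M N : ℕ} (S : Fin M → Finset (Usr U V))
    (T : Fin N → Finset (Usr U V)) (u : Fin U) (m : Fin M) (n : Fin N) : Finset (Usr U V) :=
  BigB U V (S m) (T n) u ∩ Sbar U V S T

/-- `a* = max_{u,m,n} |𝒜_{u,m,n}|`. -/
def aStar (U : ℕ) (V : Fin U → ℕ) {M N : ℕ} (S : Fin M → Finset (Usr U V))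
    (T : Fin N → Finset (Usr U V)) : ℕ :=
  Finset.univ.sup fun t : Fin U × Fin M × Fin N => (Aset U V S T t.1 t.2.1 t.2.2).card

/-- `|((𝒮_m ∩ 𝒦_{{u}}) ∪ 𝒯_n) ∩ 𝒮̄| + |𝒰^{(m,n)} ∖ {u}|`. -/
def eVal (U : ℕ) (V : Fin U → ℕ) {M N : ℕ} (S : Fin M → Finset (Usr U V))
    (T : Fin N → Finset (Usr U V)) (u : Fin U) (m : Fin M) (n : Fin N) : ℕ :=
  (((S m ∩ Ksrv U V u) ∪ T n) ∩ Sbar U V S T).card + ((UServers U V (S m) (T n)).erase u).card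

/-- `e* = max_{u,m,n} (|((𝒮_m ∩ 𝒦_{{u}}) ∪ 𝒯_n) ∩ 𝒮̄| + |𝒰^{(m,n)} ∖ {u}|)`. -/
def eStar (U : ℕ) (V : Fin U → ℕ) {M N : ℕ} (S : Fin M → Finset (Usr U V))
    (T : Fin N → Finset (Usr U V)) : ℕ :=
  Finset.univ.sup fun t : Fin U × Fin M × Fin N => eVal U V S T t.1 t.2.1 t.2.2

/-- The set `𝒬_1`. -/
def Q1set (U : ℕ) (V : Fin U → ℕ) {M N : ℕ} (S : Fin M → Finset (Usr U V))
    (T : Fin N → Finset (Usr U V)) : Finset (Usr U V) :=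
  (Finset.univ.filter fun t : Fin U × Fin M × Fin N =>
      (Aset U V S T t.1 t.2.1 t.2.2).card = (Sbar U V S T).card).biUnion
    fun t => BigB U V (S t.2.1) (T t.2.2) t.1

/-- The set `𝒬_2`. -/
def Q2set (U : ℕ) (V : Fin U → ℕ) {M N : ℕ} (S : Fin M → Finset (Usr U V))
    (T : Fin N → Finset (Usr U V)) : Finset (Usr U V) :=
  (Finset.univ.filter fun t : Fin U × Fin M × Fin N =>
      eVal U V S T t.1 t.2.1 t.2.2 = eStar U V S T).biUnion
    fun t => BigB U V (S t.2.1) (T t.2.2) t.1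

/-- The set `𝒬`. -/
def Qset (U : ℕ) (V : Fin U → ℕ) {M N : ℕ} (S : Fin M → Finset (Usr U V))
    (T : Fin N → Finset (Usr U V)) : Finset (Usr U V) :=
  if (Q1set U V S T).Nonempty then Q1set U V S T ∪ Q2set U V S T else ∅

/-- A secure-aggregation scheme: all structural, distributional, correctness and
security constraints of the multi-server secure aggregation model, with entropies in
`q`-ary units for `q = |F|`. -/
def IsScheme (U : ℕ) (V : Fin U → ℕ) (M N : ℕ) (S : Fin M → Finset (Usr U V))
    (T : Fin N → Finset (Usr U V)) (F : Type) [Field F] [Fintype F]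
    (Ω : Type) [Fintype Ω] (μ : Ω → ℝ) (L LX LY LZ LSig : ℕ)
    (W : Usr U V → Ω → Fin L → F) (Z : Usr U V → Ω → Fin LZ → F)
    (X : Usr U V → Ω → Fin LX → F) (Y : Fin U → Ω → Fin LY → F)
    (ZS : Ω → Fin LSig → F) : Prop :=
  let q := Fintype.card F
  (1 ≤ L) ∧
  (∀ ω, 0 ≤ μ ω) ∧ (∑ ω, μ ω = 1) ∧
  -- each input consists of `L` i.i.d. uniform `q`-ary symbols
  (∀ i, ent q μ (W i) = L) ∧
  -- the inputs are mutually independent of each other and of all keys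
  (ent q μ (fun ω => (restr W Finset.univ ω, restr Z Finset.univ ω)) =
    ent q μ (restr Z Finset.univ) + ∑ i, ent q μ (W i)) ∧
  -- the source key consists of `LSig` i.i.d. uniform `q`-ary symbols
  (ent q μ ZS = LSig) ∧
  -- the individual keys are deterministic functions of the source key
  (condEnt q μ (restr Z Finset.univ) ZS = 0) ∧
  -- each user message is a deterministic function of its input and key
  (∀ i, condEnt q μ (X i) (fun ω => (W i ω, Z i ω)) = 0) ∧
  -- each server message is a deterministic function of its received messages
  (∀ u, condEnt q μ (Y u) (restr X (Ksrv U V u)) = 0) ∧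
  -- correctness
  (∀ k, condEnt q μ (fun ω => ∑ i, W i ω)
    (fun ω => (restr Y (Finset.univ.erase k) ω, restr X (Ksrv U V k) ω)) = 0) ∧
  -- security
  (∀ k m n, mutInfo q μ
    (fun ω => (restr Y (Finset.univ.erase k) ω, restr X (Ksrv U V k) ω))
    (restr W (S m))
    (fun ω => (∑ i, W i ω, restr W (T n) ω, restr Z (T n) ω)) = 0)

/-- A rate tuple `(R_X, R_Y, R_{Z_Σ})` is achievable. -/
def Achievable (U : ℕ) (V : Fin U → ℕ) (M N : ℕ) (S : Fin M → Finset (Usr U V))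
    (T : Fin N → Finset (Usr U V)) (R : ℝ × ℝ × ℝ) : Prop :=
  ∃ (F : Type) (iF : Field F) (iFt : Fintype F) (Ω : Type) (iΩ : Fintype Ω)
    (μ : Ω → ℝ) (L LX LY LZ LSig : ℕ)
    (W : Usr U V → Ω → Fin L → F) (Z : Usr U V → Ω → Fin LZ → F)
    (X : Usr U V → Ω → Fin LX → F) (Y : Fin U → Ω → Fin LY → F)
    (ZS : Ω → Fin LSig → F),
    R.1 = (LX : ℝ) / (L : ℝ) ∧ R.2.1 = (LY : ℝ) / (L : ℝ) ∧ R.2.2 = (LSig : ℝ) / (L : ℝ) ∧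
    @IsScheme U V M N S T F iF iFt Ω iΩ μ L LX LY LZ LSig W Z X Y ZS

end

/-! ### Entropies of linear images of a uniform random vector -/

section LinearEntropy

variable {F : Type} [Field F] {V : Type} [AddCommGroup V] [Module F V]
  {A B C : Type} [AddCommGroup A] [Module F A] [AddCommGroup B] [Module F B]
  [AddCommGroup C] [Module F C]

theorem IsLinearMap.pair {f : V → A} {g : V → B} (hf : IsLinearMap F f) (hg : IsLinearMap F g) :
    IsLinearMap F fun v => (f v, g v) :=
  (hf.mk'.prod hg.mk').isLinear

theorem isLinearMap_restr {ι : Type} {f : ι → V → A} (hf : ∀ i, IsLinearMap F (f i))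
    (T : Finset ι) : IsLinearMap F (restr f T) :=
  (LinearMap.pi fun i : { i // i ∈ T } => (hf i.1).mk').isLinear

theorem ker_pair {f : V → A} {g : V → B} (hf : IsLinearMap F f) (hg : IsLinearMap F g) :
    LinearMap.ker (hf.pair hg).mk' = LinearMap.ker hf.mk' ⊓ LinearMap.ker hg.mk' :=
  LinearMap.ker_prod hf.mk' hg.mk'

theorem exists_dual_factor {f : V → A} (hf : IsLinearMap F f) (ψ : Module.Dual F V)
    (h : ∀ v, f v = 0 → ψ v = 0) : ∃ α : Module.Dual F A, ∀ v, ψ v = α (f v) := by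
  have : ψ ∈ LinearMap.range hf.mk'.dualMap := by
    rw [LinearMap.range_dualMap_eq_dualAnnihilator_ker, Submodule.mem_dualAnnihilator]
    exact h
  obtain ⟨α, rfl⟩ := this
  exact ⟨α, fun _ => rfl⟩

/-- The uniform weights on a finite type. -/
noncomputable def unif (V : Type) [Fintype V] : V → ℝ := fun _ => (Fintype.card V : ℝ)⁻¹

variable [Fintype F] [Fintype V]

theorem card_image_linear (f : V →ₗ[F] A) :
    (univ.image f).card = Fintype.card F ^ Module.finrank F (LinearMap.range f) := by
  have := Fintype.ofFinite (LinearMap.range f)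
  rw [← Module.card_eq_pow_finrank (K := F) (V := LinearMap.range f), ← Set.toFinset_range,
    Set.toFinset_card]
  exact Fintype.card_congr (Equiv.refl _)

theorem prb_unif_linear (f : V →ₗ[F] A) (s : A) :
    prb (unif V) f s =
      if s ∈ univ.image f then ((Fintype.card F : ℝ) ^ Module.finrank F (LinearMap.range f))⁻¹
      else 0 := by
  have hr := card_image_linear f
  split_ifs with h
  · obtain ⟨x, -, rfl⟩ := mem_image.1 h
    have hc : Fintype.card V = (univ.image f).card * #{v | f v = f x} := by
      rw [← Finset.card_univ, card_eq_sum_card_image f univ]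
      refine sum_const_nat fun b hb => ?_
      obtain ⟨y, -, rfl⟩ := mem_image.1 hb
      exact AddMonoidHom.card_fiber_eq_of_mem_range f ⟨y, rfl⟩ ⟨x, rfl⟩
    have hpos : (#{v | f v = f x} : ℝ) ≠ 0 := by
      have : 0 < #{v | f v = f x} := card_pos.2 ⟨x, by simp⟩
      positivity
    simp only [prb, unif, sum_const, nsmul_eq_mul]
    rw [hc, hr]
    push_cast
    field_simp
  · refine sum_eq_zero fun v hv => ?_
    exact absurd (mem_image.2 ⟨v, mem_univ _, (mem_filter.1 hv).2⟩) h

theorem ent_unif_linear [Fintype A] (f : V →ₗ[F] A) :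
    ent (Fintype.card F) (unif V) f = Module.finrank F (LinearMap.range f) := by
  have hr := card_image_linear f
  have hq : (1 : ℝ) < Fintype.card F := by exact_mod_cast Fintype.one_lt_card
  have h : ∀ s : A, prb (unif V) f s * Real.logb (Fintype.card F) (prb (unif V) f s) =
      if s ∈ univ.image f then
        -(((Fintype.card F : ℝ) ^ Module.finrank F (LinearMap.range f))⁻¹ *
          Module.finrank F (LinearMap.range f))
      else 0 := by
    intro s
    rw [prb_unif_linear]
    split_ifs
    · rw [Real.logb_inv, Real.logb_pow, Real.logb_self_eq_one hq]
      ring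
    · simp
  unfold ent
  simp_rw [h]
  rw [← sum_filter, sum_const, filter_mem_eq_inter, univ_inter, hr, nsmul_eq_mul]
  have : (Fintype.card F : ℝ) ≠ 0 := by positivity
  push_cast
  field_simp

theorem ent_unif_of_isLinearMap [Fintype A] {f : V → A} (hf : IsLinearMap F f) :
    ent (Fintype.card F) (unif V) f =
      Module.finrank F V - Module.finrank F (LinearMap.ker hf.mk') := by
  have h := LinearMap.finrank_range_add_finrank_ker hf.mk'
  rw [← h]
  push_cast
  rw [add_sub_cancel_right]
  exact ent_unif_linear hf.mk'

theorem ent_unif_of_surjective [Fintype A] {f : V → A} (hf : IsLinearMap F f)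
    (hs : Function.Surjective f) :
    ent (Fintype.card F) (unif V) f = Module.finrank F A := by
  rw [← finrank_top F A, ← LinearMap.range_eq_top.2 (show Function.Surjective hf.mk' from hs)]
  exact ent_unif_linear hf.mk'

theorem condEnt_unif_eq_zero [Fintype A] [Fintype B] {f : V → A} {g : V → B}
    (hf : IsLinearMap F f) (hg : IsLinearMap F g) (h : ∀ v, g v = 0 → f v = 0) :
    condEnt (Fintype.card F) (unif V) f g = 0 := by
  unfold condEnt
  have : LinearMap.ker hf.mk' ⊓ LinearMap.ker hg.mk' = LinearMap.ker hg.mk' :=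
    inf_eq_right.2 fun v hv => h v hv
  rw [ent_unif_of_isLinearMap (hf.pair hg), ent_unif_of_isLinearMap hg, ker_pair hf hg, this,
    sub_self]

theorem ent_unif_pair_eq_add [Fintype A] [Fintype B] {f : V → A} {g : V → B}
    (hf : IsLinearMap F f) (hg : IsLinearMap F g)
    (h : ∀ v, ∃ x y, f x = 0 ∧ g y = 0 ∧ v = x + y) :
    ent (Fintype.card F) (unif V) (fun v => (f v, g v)) =
      ent (Fintype.card F) (unif V) f + ent (Fintype.card F) (unif V) g := by
  have hsup : LinearMap.ker hf.mk' ⊔ LinearMap.ker hg.mk' = ⊤ := by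
    refine eq_top_iff.2 fun v _ => ?_
    obtain ⟨x, y, hx, hy, rfl⟩ := h v
    exact Submodule.add_mem_sup hx hy
  have hdim := Submodule.finrank_sup_add_finrank_inf_eq (LinearMap.ker hf.mk')
    (LinearMap.ker hg.mk')
  rw [hsup, finrank_top] at hdim
  rw [ent_unif_of_isLinearMap (hf.pair hg), ent_unif_of_isLinearMap hf,
    ent_unif_of_isLinearMap hg, ker_pair hf hg]
  have := congrArg (Nat.cast : ℕ → ℝ) hdim
  push_cast at this
  linarith

/-- A conditional mutual information between linear images of a uniform vector vanishes as soon
as every functional factoring both through `(f, h)` and through `(g, h)` factors through `h`. -/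
theorem mutInfo_unif_eq_zero [Fintype A] [Fintype B] [Fintype C] {f : V → A} {g : V → B}
    {h : V → C} (hf : IsLinearMap F f) (hg : IsLinearMap F g) (hh : IsLinearMap F h)
    (H : ∀ ψ : Module.Dual F V, (∀ v, f v = 0 → h v = 0 → ψ v = 0) →
      (∀ v, g v = 0 → h v = 0 → ψ v = 0) → ∀ v, h v = 0 → ψ v = 0) :
    mutInfo (Fintype.card F) (unif V) f g h = 0 := by
  set kf := LinearMap.ker hf.mk'
  set kg := LinearMap.ker hg.mk'
  set kh := LinearMap.ker hh.mk'
  have hsup : kf ⊓ kh ⊔ kg ⊓ kh = kh := by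
    refine le_antisymm (sup_le inf_le_right inf_le_right) fun v hv => ?_
    rw [← Subspace.forall_mem_dualAnnihilator_apply_eq_zero_iff]
    intro ψ hψ
    rw [Submodule.mem_dualAnnihilator] at hψ
    exact H ψ (fun w h1 h2 => hψ w (Submodule.mem_sup_left ⟨h1, h2⟩))
      (fun w h1 h2 => hψ w (Submodule.mem_sup_right ⟨h1, h2⟩)) v hv
  have hdim := Submodule.finrank_sup_add_finrank_inf_eq (kf ⊓ kh) (kg ⊓ kh)
  rw [hsup] at hdim
  have hinf : kf ⊓ kh ⊓ (kg ⊓ kh) = kf ⊓ (kg ⊓ kh) := by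
    rw [inf_assoc, inf_left_comm kh, inf_idem]
  rw [hinf] at hdim
  unfold mutInfo condEnt
  rw [ent_unif_of_isLinearMap (hf.pair hh), ent_unif_of_isLinearMap hh,
    ent_unif_of_isLinearMap (hf.pair (hg.pair hh)), ent_unif_of_isLinearMap (hg.pair hh),
    ker_pair hf hh,
    ker_pair hf (hg.pair hh), ker_pair hg hh]
  have := congrArg (Nat.cast : ℕ → ℝ) hdim
  push_cast at this
  linarith

end LinearEntropy

/-- Over a sufficiently large field, finitely many subspaces of dimension at most `d` admit a
common linear map to `K ^ d` that is injective on each of them. -/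
theorem exists_linearMap_injOn {K ι : Type} [Field K] [Fintype K] [Fintype ι]
    {V : Type} [AddCommGroup V] [Module K V] [FiniteDimensional K V]
    (hcard : Fintype.card ι < Fintype.card K) (d : ℕ) (D : ι → Submodule K V)
    (hD : ∀ j, Module.finrank K (D j) ≤ d) :
    ∃ φ : V →ₗ[K] (Fin d → K), ∀ j, ∀ x ∈ D j, φ x = 0 → x = 0 := by
  induction d generalizing D with
  | zero =>
    refine ⟨0, fun j x hx _ => ?_⟩
    have := Submodule.finrank_eq_zero.1 (Nat.le_zero.1 (hD j))
    rwa [this, Submodule.mem_bot] at hx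
  | succ d ih =>
    have hv : ∀ j : { j // D j ≠ ⊥ }, ∃ v ∈ D j.1, v ≠ 0 := fun j =>
      (Submodule.ne_bot_iff _).1 j.2
    choose v hvD hv0 using hv
    obtain ⟨f, hf⟩ : ∃ f : Module.Dual K V, ∀ j, f (v j) ≠ 0 := by
      have hss := Submodule.iUnion_ssubset_of_forall_ne_top_of_card_lt
        (univ : Finset { j // D j ≠ ⊥ })
        (fun j => LinearMap.ker (Module.Dual.eval K V (v j))) (fun j hj => hv0 j ?_) ?_
      · obtain ⟨f, -, hf⟩ := Set.exists_of_ssubset hss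
        refine ⟨f, fun j hj => hf ?_⟩
        simp only [Set.mem_iUnion]
        exact ⟨j, mem_univ _, hj⟩
      · rw [← Module.forall_dual_apply_eq_zero_iff K]
        intro g
        exact LinearMap.mem_ker.1 (hj ▸ Submodule.mem_top : g ∈ LinearMap.ker _)
      · rw [ENat.card_eq_coe_fintype_card]
        exact_mod_cast lt_of_le_of_lt (Fintype.card_subtype_le _) hcard
    obtain ⟨φ, hφ⟩ := ih (fun j => D j ⊓ LinearMap.ker f) fun j => by
      by_cases hj : D j = ⊥
      · rw [hj, bot_inf_eq, finrank_bot]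
        exact Nat.zero_le _
      · have hlt : D j ⊓ LinearMap.ker f < D j :=
          inf_lt_left.2 fun hle => hf ⟨j, hj⟩ (hle (hvD ⟨j, hj⟩))
        have := Submodule.finrank_lt_finrank_of_lt hlt
        have := hD j
        omega
    refine ⟨LinearMap.pi (Fin.cons f fun i => LinearMap.proj i ∘ₗ φ), fun j x hx h0 => ?_⟩
    have hcomp := fun i => congrFun h0 i
    refine hφ j x ⟨hx, ?_⟩ (funext fun i => ?_)
    · simpa using hcomp 0
    · simpa using hcomp i.succ

section Keys

variable {U : ℕ} {V : Fin U → ℕ}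

theorem card_Ksrv (u : Fin U) : (Ksrv U V u).card = V u := by
  have : Ksrv U V u = univ.image (fun v : Fin (V u) => (⟨u, v⟩ : Usr U V)) := by
    ext ⟨a, b⟩
    simp only [Ksrv, mem_filter, mem_univ, true_and, mem_image]
    constructor
    · rintro rfl
      exact ⟨b, rfl⟩
    · rintro ⟨v, hv⟩
      exact (congrArg Sigma.fst hv).symm
  rw [this, card_image_of_injective _ fun a b h => by simpa using h, card_univ, Fintype.card_fin]

theorem mem_UServers_of_subset {A B : Finset (Usr U V)} {u : Fin U}
    (hA : (A ∩ Ksrv U V u).Nonempty) (h : Ksrv U V u ⊆ A ∪ B) : u ∈ UServers U V A B := by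
  refine mem_filter.2 ⟨mem_univ _, hA, ?_⟩
  rw [inter_eq_right.2 h, card_Ksrv]

/-- A user outside `B` on which a vector supported on `A ∪ B` and constant on all servers other
than `k` does not vanish lies in `A`, at server `k` or at a fully covered server. -/
theorem mem_server_of_ne_zero {F : Type} [Field F] {A B : Finset (Usr U V)} {k : Fin U}
    {c : Usr U V → F} (hsupp : ∀ i, i ∉ A → i ∉ B → c i = 0)
    (hconst : ∀ i j, i.1 ≠ k → i.1 = j.1 → c i = c j) {i : Usr U V} (hi : i ∉ B) (hc : c i ≠ 0) :
    i ∈ A ∧ (i.1 ≠ k → i.1 ∈ UServers U V A B) := by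
  have hA : i ∈ A := by_contra fun h => hc (hsupp i h hi)
  refine ⟨hA, fun hk => mem_UServers_of_subset ⟨i, mem_inter.2 ⟨hA, by simp [Ksrv]⟩⟩ ?_⟩
  intro j hj
  have hij : i.1 = j.1 := (mem_filter.1 hj).2.symm
  by_contra hjAB
  rw [mem_union, not_or] at hjAB
  exact hc ((hconst i j hk hij).trans (hsupp j hjAB.1 hjAB.2))

/-- Existence of zero-sum keys, supported on `P`, under which the only key-free combinations of
the observations of a server and a colluding set are the unavoidable ones. -/
theorem exists_key_map (hV : ∀ u, 1 ≤ V u) {M N : ℕ} (S : Fin M → Finset (Usr U V))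
    (T : Fin N → Finset (Usr U V)) (P : Finset (Usr U V)) (d : ℕ)
    (hSP : ∀ m, S m ⊆ P)
    (hdim : ∀ k m n, (((S m ∩ Ksrv U V k) ∪ T n) ∩ P).card +
      ((UServers U V (S m) (T n)).erase k).card ≤ d)
    (hcov : ∀ k m n, ¬ P ⊆ BigB U V (S m) (T n) k)
    {F : Type} [Field F] [Fintype F]
    (hF : Fintype.card (Fin U × Fin M × Fin N) < Fintype.card F) :
    ∃ φ : (Usr U V → F) →ₗ[F] (Fin d → F), φ 1 = 0 ∧
      ∀ k m n (c t : Usr U V → F), (∀ i, i ∉ S m → i ∉ T n → c i = 0) →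
        (∀ i j, i.1 ≠ k → i.1 = j.1 → c i = c j) → (∀ i, i ∉ T n → t i = 0) →
        φ (c + t) = 0 → ∀ i, i ∉ T n → c i = 0 := by
  let K₀ : Submodule F (Usr U V → F) :=
    { carrier := {c | ∃ a, ∀ i ∈ P, c i = a}
      add_mem' := by
        rintro c c' ⟨a, ha⟩ ⟨a', ha'⟩
        exact ⟨a + a', fun i hi => by simp [ha i hi, ha' i hi]⟩
      zero_mem' := ⟨0, fun _ _ => rfl⟩
      smul_mem' := by
        rintro r c ⟨a, ha⟩
        exact ⟨r * a, fun i hi => by simp [ha i hi]⟩ }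
  let ind : Finset (Usr U V) → Usr U V → F := fun A i => if i ∈ A then 1 else 0
  let E : Fin U × Fin M × Fin N → Finset ((Usr U V → F) ⧸ K₀) := fun x =>
    ((((S x.2.1 ∩ Ksrv U V x.1) ∪ T x.2.2) ∩ P).image fun i => K₀.mkQ (Pi.single i 1)) ∪
      (((UServers U V (S x.2.1) (T x.2.2)).erase x.1).image fun u => K₀.mkQ (ind (Ksrv U V u)))
  have hE : ∀ x, Module.finrank F (Submodule.span F (E x : Set ((Usr U V → F) ⧸ K₀))) ≤ d := by
    intro x
    refine (finrank_span_finset_le_card _).trans ((card_union_le _ _).trans ?_)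
    exact (add_le_add card_image_le card_image_le).trans (hdim x.1 x.2.1 x.2.2)
  obtain ⟨φ, hφ⟩ := exists_linearMap_injOn hF d _ hE
  refine ⟨φ ∘ₗ K₀.mkQ, ?_, fun k m n c t hsupp hconst ht h0 => ?_⟩
  · have : K₀.mkQ 1 = 0 := (Submodule.Quotient.mk_eq_zero K₀).2 ⟨1, fun _ _ => rfl⟩
    rw [LinearMap.comp_apply, this, map_zero]
  let A := UServers U V (S m) (T n)
  let γ : Fin U → F := fun u => c ⟨u, ⟨0, hV u⟩⟩
  have hmem : K₀.mkQ (c + t) ∈ Submodule.span F (E (k, m, n) : Set ((Usr U V → F) ⧸ K₀)) := by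
    let r : Usr U V → F := c + t - ∑ u ∈ A.erase k, γ u • ind (Ksrv U V u)
    have hr : ∀ i, i ∉ (S m ∩ Ksrv U V k) ∪ T n → r i = 0 := by
      intro i hi
      have hiT : i ∉ T n := fun h => hi (mem_union_right _ h)
      have hsum : (∑ u ∈ A.erase k, γ u • ind (Ksrv U V u)) i =
          if i.1 ∈ A.erase k then γ i.1 else 0 := by
        simp [ind, Ksrv, Finset.sum_apply]
      have hri : r i = c i - if i.1 ∈ A.erase k then γ i.1 else 0 := by
        simp only [r, Pi.sub_apply, Pi.add_apply, hsum, ht i hiT, add_zero]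
      rw [hri]
      split_ifs with hA
      · rw [hconst i ⟨i.1, ⟨0, hV _⟩⟩ (ne_of_mem_erase hA) rfl]
        exact sub_self _
      · rw [sub_zero]
        by_contra hci
        obtain ⟨hiS, hiA⟩ := mem_server_of_ne_zero hsupp hconst hiT hci
        by_cases hk : i.1 = k
        · exact hi (mem_union_left _ (mem_inter.2 ⟨hiS, by simp [Ksrv, hk]⟩))
        · exact hA (mem_erase.2 ⟨hk, hiA hk⟩)
    have hsplit : c + t = ∑ i, r i • Pi.single i 1 + ∑ u ∈ A.erase k, γ u • ind (Ksrv U V u) := by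
      rw [← pi_eq_sum_univ' r]
      exact (sub_add_cancel _ _).symm
    rw [hsplit, map_add, map_sum, map_sum]
    refine add_mem (Submodule.sum_mem _ fun i _ => ?_) (Submodule.sum_mem _ fun u hu => ?_)
    · rw [map_smul]
      by_cases hiP : i ∈ P
      · by_cases hi : i ∈ (S m ∩ Ksrv U V k) ∪ T n
        · refine Submodule.smul_mem _ _ (Submodule.subset_span (mem_coe.2 ?_))
          exact mem_union_left _ (mem_image.2 ⟨i, mem_inter.2 ⟨hi, hiP⟩, rfl⟩)
        · rw [hr i hi, zero_smul]
          exact zero_mem _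
      · have : K₀.mkQ (Pi.single i 1) = 0 := by
          refine (Submodule.Quotient.mk_eq_zero K₀).2 ⟨0, fun j hj => ?_⟩
          exact Pi.single_eq_of_ne (ne_of_mem_of_not_mem hj hiP) _
        rw [this, smul_zero]
        exact zero_mem _
    · rw [map_smul]
      refine Submodule.smul_mem _ _ (Submodule.subset_span (mem_coe.2 ?_))
      exact mem_union_right _ (mem_image.2 ⟨u, hu, rfl⟩)
  obtain ⟨a, ha⟩ : c + t ∈ K₀ := (Submodule.Quotient.mk_eq_zero K₀).1 (hφ (k, m, n) _ hmem h0)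
  have ha0 : a = 0 := by
    by_contra hne
    refine hcov k m n fun i hi => ?_
    by_cases hiT : i ∈ T n
    · exact mem_union_right _ hiT
    have hci : c i ≠ 0 := by
      have := ha i hi
      rw [Pi.add_apply, ht i hiT, add_zero] at this
      rwa [this]
    obtain ⟨hiS, hiA⟩ := mem_server_of_ne_zero hsupp hconst hiT hci
    refine mem_union_left _ ?_
    by_cases hk : i.1 = k
    · exact mem_union_left _ (mem_inter.2 ⟨hiS, by simp [Ksrv, hk]⟩)
    · exact mem_union_right _ (mem_filter.2 ⟨mem_univ _, hiA hk⟩)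
  intro i hiT
  by_cases hiS : i ∈ S m
  · have := ha i (hSP m hiS)
    rwa [Pi.add_apply, ht i hiT, add_zero, ha0] at this
  · exact hsupp i hiS hiT

theorem le_sup_univ {α : Type} [Fintype α] (f : α → ℕ) (x : α) : f x ≤ univ.sup f :=
  le_sup (mem_univ x)

/-- The set of users that receive a nontrivial key. -/
theorem exists_key_support {M N : ℕ} (S : Fin M → Finset (Usr U V))
    (T : Fin N → Finset (Usr U V)) (hSne : (univ.biUnion fun m => S m).Nonempty)
    (hcase : aStar U V S T ≤ (Sbar U V S T).card - 1 ∨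
      (aStar U V S T = (Sbar U V S T).card ∧ (Qset U V S T).card ≤ Ktot U V - 1)) :
    ∃ P : Finset (Usr U V), (∀ m, S m ⊆ P) ∧
      (∀ k m n, (((S m ∩ Ksrv U V k) ∪ T n) ∩ P).card +
        ((UServers U V (S m) (T n)).erase k).card ≤ eStar U V S T) ∧
      ∀ k m n, ¬ P ⊆ BigB U V (S m) (T n) k := by
  have hS : ∀ m, S m ⊆ Sbar U V S T := fun m i hi =>
    mem_union_left _ (mem_biUnion.2 ⟨m, mem_univ _, hi⟩)
  have hpos : 0 < (Sbar U V S T).card := card_pos.2 (hSne.mono subset_union_left)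
  have hle : ∀ k m n, eVal U V S T k m n ≤ eStar U V S T := fun k m n => by
    have h := le_sup_univ (fun t : Fin U × Fin M × Fin N => eVal U V S T t.1 t.2.1 t.2.2) (k, m, n)
    exact h
  have hAle : ∀ k m n, (Aset U V S T k m n).card ≤ aStar U V S T := fun k m n => by
    have h := le_sup_univ
      (fun t : Fin U × Fin M × Fin N => (Aset U V S T t.1 t.2.1 t.2.2).card) (k, m, n)
    exact h
  rcases hcase with h | ⟨h, hQ⟩
  · refine ⟨Sbar U V S T, hS, hle, fun k m n hsub => ?_⟩
    have := hAle k m n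
    rw [Aset, inter_eq_right.2 hsub] at this
    omega
  have hQ1 : ∀ k m n, Sbar U V S T ⊆ BigB U V (S m) (T n) k →
      BigB U V (S m) (T n) k ⊆ Q1set U V S T := fun k m n hsub i hi =>
    mem_biUnion.2 ⟨(k, m, n), mem_filter.2 ⟨mem_univ _, by rw [Aset, inter_eq_right.2 hsub]⟩, hi⟩
  have hex : ∃ k m n, Sbar U V S T ⊆ BigB U V (S m) (T n) k := by
    by_contra! hno
    have : aStar U V S T < (Sbar U V S T).card := by
      refine (Finset.sup_lt_iff hpos).2 fun t _ => card_lt_card ?_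
      refine ⟨inter_subset_right, fun hsub => hno t.1 t.2.1 t.2.2 ?_⟩
      exact hsub.trans inter_subset_left
    omega
  obtain ⟨k₀, m₀, n₀, h₀⟩ := hex
  have hSQ : Sbar U V S T ⊆ Q1set U V S T := h₀.trans (hQ1 _ _ _ h₀)
  have hne : (Q1set U V S T).Nonempty := (card_pos.1 hpos).mono hSQ
  rw [Qset, if_pos hne] at hQ
  have hK : Fintype.card (Usr U V) = Ktot U V := by simp [Ktot]
  obtain ⟨i₀, hi₀⟩ : ∃ i, i ∉ Q1set U V S T ∪ Q2set U V S T := by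
    by_contra! hall
    have h1 : Q1set U V S T ∪ Q2set U V S T = univ := eq_univ_iff_forall.2 hall
    rw [h1, card_univ, hK] at hQ
    have h2 : (Sbar U V S T).card ≤ Ktot U V := (card_le_univ _).trans hK.le
    omega
  rw [mem_union, not_or] at hi₀
  refine ⟨insert i₀ (Sbar U V S T), fun m => (hS m).trans (subset_insert _ _),
    fun k m n => ?_, fun k m n hsub => ?_⟩
  · by_cases hi : i₀ ∈ (S m ∩ Ksrv U V k) ∪ T n
    · have hlt : eVal U V S T k m n ≠ eStar U V S T := fun heq => hi₀.2 <|
        mem_biUnion.2 ⟨(k, m, n), mem_filter.2 ⟨mem_univ _, heq⟩, by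
          rcases mem_union.1 hi with hi | hi
          · exact mem_union_left _ (mem_union_left _ hi)
          · exact mem_union_right _ hi⟩
      have hlt' := lt_of_le_of_ne (hle k m n) hlt
      rw [inter_insert_of_mem hi]
      have := card_insert_le i₀ (((S m ∩ Ksrv U V k) ∪ T n) ∩ Sbar U V S T)
      unfold eVal at hlt'
      omega
    · rw [inter_insert_of_notMem hi]
      exact hle k m n
  · have hsub' := (subset_insert _ _).trans hsub
    exact hi₀.1 (hQ1 k m n hsub' (hsub (mem_insert_self _ _)))

end Keys

section Scheme

variable {U : ℕ} {V : Fin U → ℕ} {F : Type} [Field F] {d : ℕ}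

/-- The input of user `i`, read off from the sample `(inputs, source key)`. -/
def inputOf (i : Usr U V) (ω : (Usr U V → F) × (Fin d → F)) : Fin 1 → F := fun _ => ω.1 i

/-- The key of user `i` determined by the key map `φ`. -/
def keyOf (φ : (Usr U V → F) →ₗ[F] (Fin d → F)) (i : Usr U V)
    (ω : (Usr U V → F) × (Fin d → F)) : Fin 1 → F := fun _ => φ (Pi.single i 1) ⬝ᵥ ω.2

/-- The message of user `i`: its input masked by its key. -/
def userMsg (φ : (Usr U V → F) →ₗ[F] (Fin d → F)) (i : Usr U V)
    (ω : (Usr U V → F) × (Fin d → F)) : Fin 1 → F := inputOf i ω + keyOf φ i ω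

/-- The message of server `u`: the sum of the messages of its users. -/
def serverMsg (φ : (Usr U V → F) →ₗ[F] (Fin d → F)) (u : Fin U)
    (ω : (Usr U V → F) × (Fin d → F)) : Fin 1 → F := ∑ i ∈ Ksrv U V u, userMsg φ i ω

variable (φ : (Usr U V → F) →ₗ[F] (Fin d → F))

theorem isLinearMap_inputOf (i : Usr U V) :
    IsLinearMap F (inputOf i : (Usr U V → F) × (Fin d → F) → Fin 1 → F) :=
  ⟨fun _ _ => rfl, fun _ _ => rfl⟩

theorem isLinearMap_keyOf (i : Usr U V) : IsLinearMap F (keyOf φ i) :=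
  ⟨fun x y => funext fun _ => dotProduct_add _ x.2 y.2,
    fun r x => funext fun _ => dotProduct_smul r _ x.2⟩

theorem isLinearMap_userMsg (i : Usr U V) : IsLinearMap F (userMsg φ i) :=
  ((isLinearMap_inputOf i).mk' + (isLinearMap_keyOf φ i).mk').isLinear

theorem isLinearMap_sum {ι A B : Type} [AddCommGroup A] [Module F A] [AddCommGroup B] [Module F B]
    (s : Finset ι) {f : ι → A → B} (hf : ∀ i, IsLinearMap F (f i)) :
    IsLinearMap F fun a => ∑ i ∈ s, f i a := by
  convert (∑ i ∈ s, (hf i).mk').isLinear using 1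
  ext a
  simp [LinearMap.sum_apply]

theorem isLinearMap_serverMsg (u : Fin U) : IsLinearMap F (serverMsg φ u) :=
  isLinearMap_sum _ (isLinearMap_userMsg φ)

/-- What server `k` observes: the broadcasts of the other servers and its users' messages. -/
def view (k : Fin U) (ω : (Usr U V → F) × (Fin d → F)) :
    ({ u // u ∈ univ.erase k } → Fin 1 → F) × ({ i // i ∈ Ksrv U V k } → Fin 1 → F) :=
  (restr (serverMsg φ) (univ.erase k) ω, restr (userMsg φ) (Ksrv U V k) ω)

/-- What is given for free: the aggregate, and the inputs and keys of the colluding users. -/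
def sideInfo (B : Finset (Usr U V)) (ω : (Usr U V → F) × (Fin d → F)) :
    (Fin 1 → F) × ({ i // i ∈ B } → Fin 1 → F) × ({ i // i ∈ B } → Fin 1 → F) :=
  (∑ i, inputOf i ω, restr inputOf B ω, restr (keyOf φ) B ω)

theorem isLinearMap_view (k : Fin U) : IsLinearMap F (view φ k) :=
  (isLinearMap_restr (isLinearMap_serverMsg φ) _).pair (isLinearMap_restr (isLinearMap_userMsg φ) _)

theorem isLinearMap_sideInfo (B : Finset (Usr U V)) : IsLinearMap F (sideInfo φ B) :=
  (isLinearMap_sum _ isLinearMap_inputOf).pair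
    ((isLinearMap_restr isLinearMap_inputOf _).pair (isLinearMap_restr (isLinearMap_keyOf φ) _))

theorem sum_mul_key (c : Usr U V → F) (N : Fin d → F) :
    ∑ i, c i * (φ (Pi.single i 1) ⬝ᵥ N) = φ c ⬝ᵥ N := by
  conv_rhs => rw [pi_eq_sum_univ' c, map_sum, sum_dotProduct]
  simp_rw [map_smul, smul_dotProduct, smul_eq_mul]

/-- A linear functional on user-indexed vectors is given by its coefficients. -/
theorem linear_apply_eq_sum (f : Module.Dual F (Usr U V → F)) (x : Usr U V → F) :
    f x = ∑ i, f (Pi.single i 1) * x i := by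
  conv_lhs => rw [pi_eq_sum_univ' x, map_sum]
  simp_rw [map_smul, smul_eq_mul, mul_comm]

/-- A functional of the view is a combination of the user messages with coefficients constant on
the servers other than `k`. -/
theorem exists_view_coeff (k : Fin U)
    (α : Module.Dual F
      (({ u // u ∈ univ.erase k } → Fin 1 → F) × ({ i // i ∈ Ksrv U V k } → Fin 1 → F))) :
    ∃ c : Usr U V → F, (∀ i j, i.1 ≠ k → i.1 = j.1 → c i = c j) ∧
      ∀ ω, α (view φ k ω) = ∑ i, c i * (ω.1 i + φ (Pi.single i 1) ⬝ᵥ ω.2) := by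
  let G : (Usr U V → F) → ({ u // u ∈ univ.erase k } → Fin 1 → F) ×
      ({ i // i ∈ Ksrv U V k } → Fin 1 → F) := fun x =>
    (fun u _ => ∑ i ∈ Ksrv U V u.1, x i, fun i _ => x i.1)
  have hG : IsLinearMap F G := by
    refine ⟨fun x y => ?_, fun r x => ?_⟩
    · ext <;> simp [G, sum_add_distrib]
    · ext <;> simp [G, mul_sum]
  refine ⟨fun i => α (G (Pi.single i 1)), fun i j hi hij => ?_, fun ω => ?_⟩
  · have : G (Pi.single i 1) = G (Pi.single j 1) := by
      refine Prod.ext (funext fun u => funext fun _ => ?_) (funext fun l => funext fun _ => ?_)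
      · simp [G, Ksrv, Pi.single_apply, Finset.sum_ite_eq', hij]
      · have hl : l.1.1 = k := (mem_filter.1 l.2).2
        have h1 : l.1 ≠ i := fun h => hi (h ▸ hl)
        have h2 : l.1 ≠ j := fun h => hi (hij.trans (h ▸ hl))
        simp [G, h1, h2]
    simp only [this]
  · have hv : view φ k ω = G fun i => ω.1 i + φ (Pi.single i 1) ⬝ᵥ ω.2 := by
      refine Prod.ext (funext fun u => funext fun _ => ?_) rfl
      simp [view, G, restr, serverMsg, userMsg, inputOf, keyOf, Finset.sum_apply]
    rw [hv]
    exact linear_apply_eq_sum (α ∘ₗ hG.mk') _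

theorem exists_restr_coeff (B : Finset (Usr U V))
    (α : Module.Dual F ({ i // i ∈ B } → Fin 1 → F)) :
    ∃ t : Usr U V → F, (∀ i, i ∉ B → t i = 0) ∧
      ∀ x : Usr U V → F, α (fun i _ => x i.1) = ∑ i, t i * x i := by
  let G : (Usr U V → F) → { i // i ∈ B } → Fin 1 → F := fun x i _ => x i.1
  have hG : IsLinearMap F G := ⟨fun _ _ => rfl, fun _ _ => rfl⟩
  refine ⟨fun i => α (G (Pi.single i 1)), fun i hi => ?_, linear_apply_eq_sum (α ∘ₗ hG.mk')⟩
  have : G (Pi.single i 1) = 0 := by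
    refine funext fun l => funext fun _ => ?_
    have : l.1 ≠ i := fun h => hi (h ▸ l.2)
    simp [G, this]
  change α (G (Pi.single i 1)) = 0
  rw [this, map_zero]

theorem exists_sideInfo_coeff (B : Finset (Usr U V))
    (α : Module.Dual F
      ((Fin 1 → F) × ({ i // i ∈ B } → Fin 1 → F) × ({ i // i ∈ B } → Fin 1 → F))) :
    ∃ (a : F) (t τ : Usr U V → F), (∀ i, i ∉ B → t i = 0) ∧ (∀ i, i ∉ B → τ i = 0) ∧
      ∀ ω, α (sideInfo φ B ω) = a * ∑ i, ω.1 i + ∑ i, t i * ω.1 i +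
        ∑ i, τ i * (φ (Pi.single i 1) ⬝ᵥ ω.2) := by
  obtain ⟨t, ht, ht'⟩ := exists_restr_coeff B (α ∘ₗ LinearMap.inr F _ _ ∘ₗ LinearMap.inl F _ _)
  obtain ⟨τ, hτ, hτ'⟩ := exists_restr_coeff B (α ∘ₗ LinearMap.inr F _ _ ∘ₗ LinearMap.inr F _ _)
  refine ⟨α (1, 0, 0), t, τ, ht, hτ, fun ω => ?_⟩
  rw [← ht', ← hτ', mul_comm, ← smul_eq_mul, ← map_smul]
  simp only [LinearMap.comp_apply, ← map_add]
  congr 1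
  refine Prod.ext (funext fun _ => ?_) (Prod.ext (funext fun _ => funext fun _ => ?_)
    (funext fun _ => funext fun _ => ?_)) <;>
  simp [sideInfo, restr, inputOf, keyOf, Finset.sum_apply]

/-- Security of the masked aggregation scheme, given the linear independence property of the
keys. -/
theorem mutInfo_view_eq_zero [Fintype F] (hφ1 : φ 1 = 0) (A B : Finset (Usr U V)) (k : Fin U)
    (hφ : ∀ c t : Usr U V → F, (∀ i, i ∉ A → i ∉ B → c i = 0) →
        (∀ i j, i.1 ≠ k → i.1 = j.1 → c i = c j) → (∀ i, i ∉ B → t i = 0) →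
        φ (c + t) = 0 → ∀ i, i ∉ B → c i = 0) :
    mutInfo (Fintype.card F) (unif _) (view φ k) (restr inputOf A) (sideInfo φ B) = 0 := by
  have hA : IsLinearMap F (restr (inputOf : Usr U V → (Usr U V → F) × (Fin d → F) → _) A) :=
    isLinearMap_restr isLinearMap_inputOf A
  refine mutInfo_unif_eq_zero (isLinearMap_view φ k) hA (isLinearMap_sideInfo φ B) ?_
  intro ψ h1 h2 ω hω
  obtain ⟨α, hα⟩ := exists_dual_factor ((isLinearMap_view φ k).pair (isLinearMap_sideInfo φ B)) ψ
    fun v hv => h1 v (congrArg Prod.fst hv) (congrArg Prod.snd hv)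
  obtain ⟨β, hβ⟩ := exists_dual_factor (hA.pair (isLinearMap_sideInfo φ B)) ψ
    fun v hv => h2 v (congrArg Prod.fst hv) (congrArg Prod.snd hv)
  obtain ⟨c, hc, hc'⟩ := exists_view_coeff φ k (α ∘ₗ LinearMap.inl F _ _)
  obtain ⟨a, t, τ, ht, hτ, hC⟩ := exists_sideInfo_coeff φ B (α ∘ₗ LinearMap.inr F _ _)
  obtain ⟨s, hs, hs'⟩ := exists_restr_coeff A (β ∘ₗ LinearMap.inl F _ _)
  obtain ⟨a', t', τ', ht', hτ', hC'⟩ := exists_sideInfo_coeff φ B (β ∘ₗ LinearMap.inr F _ _)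
  have e1 : ∀ v, ψ v = ∑ i, c i * (v.1 i + φ (Pi.single i 1) ⬝ᵥ v.2) + (a * ∑ i, v.1 i +
      ∑ i, t i * v.1 i + ∑ i, τ i * (φ (Pi.single i 1) ⬝ᵥ v.2)) := by
    intro v
    rw [hα, ← hc', ← hC]
    simp [← map_add]
  have e2 : ∀ v, ψ v = ∑ i, s i * v.1 i + (a' * ∑ i, v.1 i +
      ∑ i, t' i * v.1 i + ∑ i, τ' i * (φ (Pi.single i 1) ⬝ᵥ v.2)) := by
    intro v
    rw [hβ, ← hs' v.1, ← hC']
    simp only [LinearMap.comp_apply, ← map_add]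
    congr 1
    simp only [LinearMap.inl_apply, LinearMap.inr_apply, Prod.mk_add_mk, add_zero, zero_add]
    rfl
  have hw : ∀ i, c i + a + t i = s i + a' + t' i := by
    intro i
    have h := (e1 (Pi.single i 1, 0)).symm.trans (e2 (Pi.single i 1, 0))
    simp only [dotProduct_zero, add_zero, mul_zero, sum_const_zero, Pi.single_apply, mul_ite,
      mul_one, sum_ite_eq', mem_univ, if_true] at h
    linear_combination h
  have hz : φ (c + (τ - τ')) = 0 := by
    refine dotProduct_eq_zero _ fun N => ?_
    have h := (e1 (0, N)).symm.trans (e2 (0, N))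
    simp only [Pi.zero_apply, zero_add, mul_zero, sum_const_zero, sum_mul_key] at h
    rw [map_add, map_sub, add_dotProduct, sub_dotProduct]
    linear_combination h
  have hcB : ∀ i, i ∉ B → c i + (a - a') = 0 := by
    refine hφ (fun i => c i + (a - a')) (τ - τ') (fun i hiA hiB => ?_) (fun i j hi hij => ?_)
      (fun i hi => ?_) ?_
    · have := hw i
      rw [hs i hiA, ht i hiB, ht' i hiB] at this
      linear_combination this
    · simp only [hc i j hi hij]
    · simp [hτ i hi, hτ' i hi]
    · have : (fun i => c i + (a - a')) + (τ - τ') = (c + (τ - τ')) + (a - a') • 1 := by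
        ext i
        simp only [Pi.add_apply, Pi.sub_apply, Pi.smul_apply, Pi.one_apply, smul_eq_mul]
        ring
      rw [this, map_add, map_smul, hφ1, hz, smul_zero, add_zero]
  have hsum : ∑ i, ω.1 i = 0 := by
    have := congrFun (congrArg Prod.fst hω) 0
    simpa [sideInfo, inputOf, Finset.sum_apply] using this
  have hwB : ∀ i ∈ B, ω.1 i = 0 := fun i hi =>
    congrFun (congrFun (congrArg (fun x => x.2.1) hω) ⟨i, hi⟩) 0
  have hzB : ∀ i ∈ B, φ (Pi.single i 1) ⬝ᵥ ω.2 = 0 := fun i hi =>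
    congrFun (congrFun (congrArg (fun x => x.2.2) hω) ⟨i, hi⟩) 0
  have hzsum : ∑ i, φ (Pi.single i 1) ⬝ᵥ ω.2 = 0 := by
    have := sum_mul_key φ 1 ω.2
    simpa [hφ1] using this
  have hkill : ∀ (r x : Usr U V → F), (∀ i, i ∉ B → r i = 0) → (∀ i ∈ B, x i = 0) →
      ∑ i, r i * x i = 0 := fun r x hr hx => sum_eq_zero fun i _ => by
    by_cases hi : i ∈ B
    · rw [hx i hi, mul_zero]
    · rw [hr i hi, zero_mul]
  have hmain := hkill (fun i => c i + (a - a')) (fun i => ω.1 i + φ (Pi.single i 1) ⬝ᵥ ω.2) hcB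
    fun i hi => by rw [hwB i hi, hzB i hi, add_zero]
  simp only [add_mul, sum_add_distrib] at hmain
  rw [← mul_sum, sum_add_distrib, hsum, hzsum, add_zero, mul_zero, add_zero] at hmain
  rw [e1, hmain, hsum, hkill t ω.1 ht hwB, hkill τ _ hτ hzB]
  simp

/-- Correctness of the masked aggregation scheme. -/
theorem sum_input_eq_zero (hφ1 : φ 1 = 0) (k : Fin U) (ω : (Usr U V → F) × (Fin d → F))
    (hω : view φ k ω = 0) : ∑ i, inputOf i ω = 0 := by
  have hserver : ∀ u, serverMsg φ u ω = 0 := by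
    intro u
    by_cases hu : u = k
    · subst hu
      exact sum_eq_zero fun i hi => congrFun (congrArg Prod.snd hω) ⟨i, hi⟩
    · exact congrFun (congrArg Prod.fst hω) ⟨u, mem_erase.2 ⟨hu, mem_univ _⟩⟩
  have hmsg : ∑ i : Usr U V, userMsg φ i ω = 0 := by
    rw [← sum_fiberwise univ (fun i : Usr U V => i.1)]
    exact sum_eq_zero fun u _ => hserver u
  have hkey : ∑ i : Usr U V, keyOf φ i ω = 0 := by
    ext j
    have := sum_mul_key φ 1 ω.2
    simpa [hφ1, keyOf, Finset.sum_apply] using this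
  simpa [userMsg, sum_add_distrib, hkey] using hmsg

end Scheme

theorem stmt19_achievability_eStar
    (U : ℕ) (hU : 3 ≤ U) (V : Fin U → ℕ) (hV : ∀ u, 1 ≤ V u)
    (M N : ℕ) (S : Fin M → Finset (Usr U V)) (T : Fin N → Finset (Usr U V))
    (hSmono : ∀ (m : Fin M) (A : Finset (Usr U V)), A ⊆ S m → ∃ m', S m' = A)
    (hTmono : ∀ (n : Fin N) (A : Finset (Usr U V)), A ⊆ T n → ∃ n', T n' = A)
    (hSne : (Finset.univ.biUnion fun m => S m).Nonempty)
    (hTcard : ∀ n, (T n).card ≤ Ktot U V - 2)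
    (he : eStar U V S T ≤ Ktot U V - 1)
    (hcase : aStar U V S T ≤ (Sbar U V S T).card - 1 ∨
      (aStar U V S T = (Sbar U V S T).card ∧ (Qset U V S T).card ≤ Ktot U V - 1)) :
    ∃ (F : Type) (iF : Field F) (iFt : Fintype F) (Ω : Type) (iΩ : Fintype Ω)
      (μ : Ω → ℝ) (L LZ : ℕ)
      (W : Usr U V → Ω → Fin L → F) (Z : Usr U V → Ω → Fin LZ → F)
      (X : Usr U V → Ω → Fin L → F) (Y : Fin U → Ω → Fin L → F)
      (ZS : Ω → Fin (eStar U V S T * L) → F),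
      @IsScheme U V M N S T F iF iFt Ω iΩ μ L L L LZ (eStar U V S T * L) W Z X Y ZS := by
  obtain ⟨P, hSP, hdim, hcov⟩ := exists_key_support S T hSne hcase
  obtain ⟨p, hp, hprime⟩ := Nat.exists_infinite_primes (Fintype.card (Fin U × Fin M × Fin N) + 1)
  have : Fact p.Prime := ⟨hprime⟩
  have hF : Fintype.card (Fin U × Fin M × Fin N) < Fintype.card (ZMod p) := by
    rwa [ZMod.card]
  obtain ⟨φ, hφ1, hφ⟩ := exists_key_map hV S T P (eStar U V S T * 1) hSP
    (by simpa only [mul_one] using hdim) hcov hF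
  have hW : IsLinearMap (ZMod p) (restr (inputOf (V := V) (F := ZMod p)
      (d := eStar U V S T * 1)) univ) := isLinearMap_restr isLinearMap_inputOf _
  have hZ := isLinearMap_restr (isLinearMap_keyOf φ) univ
  have hWi : ∀ i, ent (Fintype.card (ZMod p)) (unif _)
      (inputOf (V := V) (F := ZMod p) (d := eStar U V S T * 1) i) = 1 := fun i => by
    rw [ent_unif_of_surjective (isLinearMap_inputOf i) fun w =>
      ⟨(fun _ => w 0, 0), funext fun j => congrArg w (Subsingleton.elim _ _)⟩]
    simp
  refine ⟨ZMod p, inferInstance, inferInstance,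
    (Usr U V → ZMod p) × (Fin (eStar U V S T * 1) → ZMod p), inferInstance, unif _, 1, 1,
    inputOf, keyOf φ, userMsg φ, serverMsg φ, Prod.snd, le_rfl, fun _ => ?_, ?_, fun i => ?_, ?_,
    ?_, ?_, fun i => ?_, fun u => ?_, fun k => ?_, fun k m n => ?_⟩
  · unfold unif
    positivity
  · unfold unif
    rw [sum_const, card_univ, nsmul_eq_mul]
    exact mul_inv_cancel₀ (Nat.cast_ne_zero.2 Fintype.card_ne_zero)
  · rw [hWi, Nat.cast_one]
  · rw [ent_unif_pair_eq_add hW hZ fun v => ⟨(0, v.2), (v.1, 0), rfl,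
      funext fun i => funext fun _ => dotProduct_zero (φ (Pi.single i.1 1)), by simp⟩, add_comm]
    congr 1
    rw [sum_congr rfl fun i _ => hWi i, ent_unif_of_surjective hW fun w =>
      ⟨(fun i => w ⟨i, mem_univ i⟩ 0, 0), funext fun i => funext fun j =>
        congrArg (w i) (Subsingleton.elim _ _)⟩]
    simp [Module.finrank_pi_fintype]
  · rw [ent_unif_of_surjective (F := ZMod p) ⟨fun _ _ => rfl, fun _ _ => rfl⟩
      Prod.snd_surjective]
    simp
  · refine condEnt_unif_eq_zero hZ ⟨fun _ _ => rfl, fun _ _ => rfl⟩ fun v hv => ?_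
    exact funext fun i => funext fun _ => (congrArg _ hv).trans (dotProduct_zero _)
  · refine condEnt_unif_eq_zero (isLinearMap_userMsg φ i)
      ((isLinearMap_inputOf i).pair (isLinearMap_keyOf φ i)) fun v hv => ?_
    rw [Prod.mk_eq_zero] at hv
    rw [userMsg, hv.1, hv.2, add_zero]
  · refine condEnt_unif_eq_zero (isLinearMap_serverMsg φ u)
      (isLinearMap_restr (isLinearMap_userMsg φ) _) fun v hv => ?_
    exact sum_eq_zero fun i hi => congrFun hv ⟨i, hi⟩
  · refine condEnt_unif_eq_zero (isLinearMap_sum _ isLinearMap_inputOf) (isLinearMap_view φ k)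
      fun v hv => ?_
    exact sum_input_eq_zero φ hφ1 k v hv
  · exact mutInfo_view_eq_zero φ hφ1 (S m) (T n) k (hφ k m n)
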